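/- Every finite subgroup of PGL₂(𝔽̄_ℓ) (ℓ > 5) containing an element of order greater than 5 and acting irreducibly, which is neither conjugate to a subgroup of the upper triangular matrices (reducible/abelian-by-cyclic case) nor dihedral (normalizer of a torus), must be conjugate to PSL₂(𝔽_{ℓ^s}) or PGL₂(𝔽_{ℓ^s}) for some s > 0. -/

import Mathlib

open Matrix

section Orbits

open MulAction

variable {G X : Type*} [Group G] [MulAction G X]

theorem card_dvd_ncard_of_free [Finite G] {S : Set X} (hfin : S.Finite)
    (hS : ∀ (g : G), ∀ x ∈ S, g • x ∈ S) (hfree : ∀ (g : G), ∀ x ∈ S, g • x = x → g = 1) :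
    Nat.card G ∣ S.ncard := by
  classical
  let T : SubMulAction G X := ⟨S, fun g {x} hx => hS g x hx⟩
  have : Finite T := hfin
  have : Fintype (Quotient (orbitRel G T)) := Fintype.ofFinite _
  have key := Nat.card_congr (selfEquivSigmaOrbitsQuotientStabilizer G T)
  have hst : ∀ t : T, Nat.card (G ⧸ stabilizer G t) = Nat.card G := by
    intro t
    have : stabilizer G t = ⊥ := by
      rw [eq_bot_iff]
      intro g hg
      exact hfree g t t.2 (congrArg Subtype.val hg)
    rw [this]
    exact Nat.card_congr (QuotientGroup.quotientBot (G := G)).toEquiv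
  rw [Nat.card_sigma, Finset.sum_congr rfl fun t _ => hst t.out, Finset.sum_const,
    smul_eq_mul] at key
  rw [← Nat.card_coe_set_eq]
  exact Dvd.intro_left _ key.symm

/-- The subgroups `U x` consist of the identity and the elements fixing only `x`. -/
def IsUnipotentFamily (U : X → Subgroup G) : Prop :=
  ∀ x g, g ∈ U x ↔ g = 1 ∨ fixedBy X g = {x}

variable {U : X → Subgroup G}

theorem IsUnipotentFamily.le_stabilizer (hU : IsUnipotentFamily U) (x : X) :
    U x ≤ stabilizer G x := by
  intro g hg
  rcases (hU x g).1 hg with rfl | h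
  · exact one_mem _
  · exact mem_fixedBy.1 (h ▸ Set.mem_singleton x)

theorem IsUnipotentFamily.eq_of_smul_eq (hU : IsUnipotentFamily U) {x y : X} {g : G}
    (hg : g ∈ U x) (hg1 : g ≠ 1) (hy : g • y = y) : y = x := by
  have h := ((hU x g).1 hg).resolve_left hg1
  have : y ∈ fixedBy X g := hy
  simpa [h] using this

open scoped Pointwise in
theorem IsUnipotentFamily.card_smul (hU : IsUnipotentFamily U) (g : G) (x : X) :
    Nat.card (U (g • x)) = Nat.card (U x) := by
  have : U (g • x) = (U x).map (MulAut.conj g).toMonoidHom := by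
    ext h
    rw [Subgroup.mem_map_equiv, hU, hU, MulAut.conj_symm_apply, ← Set.smul_set_singleton]
    have h1 := smul_fixedBy (α := X) (g⁻¹ * h * g) g
    have h2 : g * (g⁻¹ * h * g) * g⁻¹ = h := by group
    rw [h2] at h1
    rw [← h1, smul_left_cancel_iff]
    refine or_congr ?_ Iff.rfl
    rw [mul_eq_one_iff_eq_inv, inv_mul_eq_iff_eq_mul]; simp
  rw [this]
  exact (Nat.card_congr ((U x).equivMapOfInjective _ (MulAut.conj g).injective).toEquiv).symm

theorem card_orbit_mul_card_stabilizer' (x : X) :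
    Nat.card (orbit G x) * Nat.card (stabilizer G x) = Nat.card G := by
  rw [Nat.card_congr (orbitEquivQuotientStabilizer G x)]
  exact (Subgroup.card_eq_card_quotient_mul_card_subgroup _).symm

/-- The number of nontrivial elements fixing `x`, those fixing only `x` being counted twice. -/
noncomputable def fixWeight (U : X → Subgroup G) (x : X) : ℤ :=
  Nat.card (stabilizer G x) + Nat.card (U x) - 2

theorem fixWeight_nonneg [Finite G] (x : X) : 0 ≤ fixWeight U x := by
  have h1 : 0 < Nat.card (stabilizer G x) := Nat.card_pos
  have h2 : 0 < Nat.card (U x) := Nat.card_pos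
  unfold fixWeight
  omega

theorem exists_sum_fixWeight [Finite G] (hU : IsUnipotentFamily U)
    (h2 : ∀ g : G, g ≠ 1 → (fixedBy X g).ncard = 1 ∨ (fixedBy X g).ncard = 2) :
    ∃ Y : Finset X, (∀ x, x ∈ Y ↔ ∃ g : G, g ≠ 1 ∧ g • x = x) ∧
      ∑ x ∈ Y, fixWeight U x = 2 * ((Nat.card G : ℤ) - 1) := by
  classical
  have := Fintype.ofFinite G
  have hF : ∀ g : G, g ≠ 1 → (fixedBy X g).Finite := fun g hg => by
    apply Set.finite_of_ncard_ne_zero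
    have := h2 g hg
    omega
  have hYf : (⋃ g ∈ {g : G | g ≠ 1}, fixedBy X g).Finite := (Set.toFinite _).biUnion hF
  have hY : ∀ x, x ∈ hYf.toFinset ↔ ∃ g : G, g ≠ 1 ∧ g • x = x := by simp
  refine ⟨hYf.toFinset, hY, ?_⟩
  have hw : ∀ x, fixWeight U x = ∑ g ∈ Finset.univ.erase (1 : G),
      ((if g • x = x then 1 else 0) + (if g ∈ U x then 1 else 0) : ℤ) := by
    intro x
    rw [Finset.sum_erase_eq_sub (Finset.mem_univ _), Finset.sum_add_distrib, Finset.sum_boole,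
      Finset.sum_boole, fixWeight, Nat.card_eq_fintype_card, Nat.card_eq_fintype_card,
      Fintype.card_subtype, Fintype.card_subtype]
    simp [one_mem]
  simp_rw [hw]
  rw [Finset.sum_comm, Finset.sum_congr rfl (g := fun _ => (2 : ℤ))]
  · rw [Finset.sum_const, Finset.card_erase_of_mem (Finset.mem_univ _), Finset.card_univ,
      Nat.card_eq_fintype_card, nsmul_eq_mul, Nat.cast_sub Fintype.card_pos]
    push_cast; ring
  intro g hg
  have hg1 : g ≠ 1 := (Finset.mem_erase.1 hg).1
  have e1 : hYf.toFinset.filter (fun x => g • x = x) = (hF g hg1).toFinset := by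
    ext x
    simp only [Finset.mem_filter, hY, Set.Finite.mem_toFinset, mem_fixedBy]
    exact ⟨fun h => h.2, fun h => ⟨⟨g, hg1, h⟩, h⟩⟩
  rw [Finset.sum_add_distrib, Finset.sum_boole, Finset.sum_boole, e1,
    ← Set.ncard_eq_toFinset_card _ (hF g hg1)]
  rcases h2 g hg1 with h | h
  · obtain ⟨x, hx⟩ := Set.ncard_eq_one.1 h
    have : hYf.toFinset.filter (fun x => g ∈ U x) = {x} := by
      ext y
      simp only [Finset.mem_filter, hY, Finset.mem_singleton]
      constructor
      · rintro ⟨-, hy⟩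
        have := ((hU y g).1 hy).resolve_left hg1
        rw [hx] at this
        exact (Set.singleton_injective this).symm
      · rintro rfl
        have hy : g • y = y := mem_fixedBy.1 (hx ▸ Set.mem_singleton y)
        exact ⟨⟨g, hg1, hy⟩, (hU y g).2 (Or.inr hx)⟩
    rw [this, h]; simp
  · have : hYf.toFinset.filter (fun x => g ∈ U x) = ∅ := by
      ext y
      simp only [Finset.mem_filter, Finset.notMem_empty, iff_false, not_and]
      intro _ hy
      have := ((hU y g).1 hy).resolve_left hg1
      rw [this] at h
      simp at h
    rw [this, h]; simp

theorem exists_sum_fixWeight_sub_orbit [Finite G] (hU : IsUnipotentFamily U) {S : Finset X}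
    (hS : ∀ (g : G), ∀ x ∈ S, g • x ∈ S) {y : X} (hy : y ∈ S) :
    ∃ T : Finset X, (∀ x, x ∈ T ↔ x ∈ S ∧ x ∉ orbit G y) ∧ (∀ (g : G), ∀ x ∈ T, g • x ∈ T) ∧
      ∑ x ∈ S, fixWeight U x = ∑ x ∈ T, fixWeight U x +
        (Nat.card G + Nat.card (orbit G y) * ((Nat.card (U y) : ℤ) - 2)) := by
  classical
  have hT : ∀ x, x ∈ S.filter (fun x => x ∉ orbit G y) ↔ x ∈ S ∧ x ∉ orbit G y := by simp
  refine ⟨S.filter (fun x => x ∉ orbit G y), hT, ?_, ?_⟩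
  · intro g x hx
    rw [hT] at hx ⊢
    exact ⟨hS g x hx.1, fun h => hx.2 (by
      rw [← orbit_eq_iff] at h ⊢; rwa [orbit_smul] at h)⟩
  · rw [← Finset.sum_filter_add_sum_filter_not S (fun x => x ∉ orbit G y)]
    congr 1
    rw [Finset.sum_congr rfl (g := fun _ => fixWeight U y)]
    · have hc : (S.filter (fun x => ¬ x ∉ orbit G y)).card = Nat.card (orbit G y) := by
        rw [Nat.card_coe_set_eq, ← Set.ncard_coe_finset]
        congr 1
        ext x
        simp only [Finset.coe_filter, not_not, Set.mem_ofPred_eq]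
        refine ⟨fun h => h.2, ?_⟩
        rintro ⟨g, rfl⟩
        exact ⟨hS g y hy, mem_orbit y g⟩
      rw [Finset.sum_const, hc, fixWeight, ← card_orbit_mul_card_stabilizer' (G := G) y]
      push_cast; ring
    · intro x hx
      obtain ⟨g, rfl⟩ := not_not.1 (Finset.mem_filter.1 hx).2
      simp only [fixWeight, hU.card_smul]
      rw [stabilizer_smul_eq_stabilizer_map_conj,
        Nat.card_congr ((stabilizer G y).equivMapOfInjective (MulAut.conj g).toMonoidHom
          (MulAut.conj g).injective).toEquiv]

end Orbits

section Counting

open MulAction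

variable {G X : Type*} [Group G] [MulAction G X]

theorem isUnipotentFamily_bot (hfix : ∀ g : G, g ≠ 1 → (fixedBy X g).ncard = 2) :
    IsUnipotentFamily fun _ : X => (⊥ : Subgroup G) := by
  intro x g
  rw [Subgroup.mem_bot]
  refine ⟨Or.inl, ?_⟩
  rintro (h | h)
  · exact h
  · by_contra hg
    have := hfix g hg
    rw [h] at this
    simp at this

theorem exists_mem_of_sum_fixWeight_pos {U : X → Subgroup G} {S : Finset X}
    (h : 0 < ∑ x ∈ S, fixWeight U x) : ∃ x, x ∈ S := by
  by_contra hS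
  push Not at hS
  rw [Finset.eq_empty_of_forall_notMem hS] at h
  simp at h

variable [Finite G]

theorem two_mul_card_orbit_le {x : X} {g : G} (hg : g ≠ 1) (hx : g • x = x) :
    2 * Nat.card (orbit G x) ≤ Nat.card G := by
  rw [← card_orbit_mul_card_stabilizer' (G := G) x, mul_comm]
  refine Nat.mul_le_mul_left _ ?_
  have : Nontrivial (stabilizer G x) :=
    ⟨⟨⟨g, hx⟩, 1, fun h => hg (congrArg Subtype.val h)⟩⟩
  exact Finite.one_lt_card

theorem two_le_card_orbit {x : X} (hx : ∃ g : G, g • x ≠ x) : 2 ≤ Nat.card (orbit G x) := by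
  obtain ⟨g, hg⟩ := hx
  have : Finite (orbit G x) := Set.finite_range _
  have : Nontrivial (orbit G x) :=
    ⟨⟨⟨g • x, mem_orbit x g⟩, ⟨x, mem_orbit_self x⟩, fun h => hg (congrArg Subtype.val h)⟩⟩
  exact Finite.one_lt_card

theorem sum_fixWeight_nonneg {U : X → Subgroup G} {S : Finset X} :
    0 ≤ ∑ x ∈ S, fixWeight U x :=
  Finset.sum_nonneg fun x _ => fixWeight_nonneg x

theorem exists_card_orbit_eq_two (hfix : ∀ g : G, g ≠ 1 → (fixedBy X g).ncard = 2)
    (hmove : ∀ x : X, ∃ g : G, g • x ≠ x) {x : X} (hx : 6 ≤ Nat.card (stabilizer G x)) :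
    Nat.card (orbit G x) = 2 := by
  have hU := isUnipotentFamily_bot hfix
  obtain ⟨Y, hY, hsum⟩ := exists_sum_fixWeight hU fun g hg => Or.inr (hfix g hg)
  have hle : ∀ z ∈ Y, 2 * Nat.card (orbit G z) ≤ Nat.card G := by
    intro z hz
    obtain ⟨g, hg, hgz⟩ := (hY z).1 hz
    exact two_mul_card_orbit_le hg hgz
  have hYinv : ∀ (g : G), ∀ z ∈ Y, g • z ∈ Y := by
    intro g z hz
    obtain ⟨h, hh, hz⟩ := (hY z).1 hz
    refine (hY _).2 ⟨g * h * g⁻¹, by simpa using hh, ?_⟩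
    simp [mul_smul, hz]
  have hxY : x ∈ Y := by
    have : Nontrivial (stabilizer G x) := Finite.one_lt_card_iff_nontrivial.1 (by omega)
    obtain ⟨⟨g, hg⟩, hg1⟩ := exists_ne (1 : stabilizer G x)
    exact (hY x).2 ⟨g, fun h => hg1 (Subtype.ext h), hg⟩
  have hn := card_orbit_mul_card_stabilizer' (G := G) x
  have hn2 := two_le_card_orbit (hmove x)
  obtain ⟨S, hS, hSinv, e1⟩ := exists_sum_fixWeight_sub_orbit hU hYinv hxY
  simp only [Subgroup.card_bot] at e1
  obtain ⟨y, hy⟩ := exists_mem_of_sum_fixWeight_pos (U := fun _ : X => (⊥ : Subgroup G)) (S := S)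
    (by
      have : 0 < Nat.card G := Nat.card_pos
      push_cast at *
      omega)
  have hy2 := two_le_card_orbit (hmove y)
  have hyY := hle y ((hS y).1 hy).1
  obtain ⟨T, hT, hTinv, e2⟩ := exists_sum_fixWeight_sub_orbit hU hSinv hy
  simp only [Subgroup.card_bot] at e2
  obtain ⟨z, hz⟩ := exists_mem_of_sum_fixWeight_pos (U := fun _ : X => (⊥ : Subgroup G)) (S := T)
    (by push_cast at *; omega)
  have hzY := hle z ((hS z).1 ((hT z).1 hz).1).1
  obtain ⟨R, hR, hRinv, e3⟩ := exists_sum_fixWeight_sub_orbit hU hTinv hz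
  simp only [Subgroup.card_bot] at e3
  have hR0 : R = ∅ := by
    by_contra hne
    obtain ⟨w, hw⟩ := Finset.nonempty_of_ne_empty hne
    have hwY := hle w ((hS w).1 ((hT w).1 ((hR w).1 hw).1).1).1
    obtain ⟨Q, -, -, e4⟩ := exists_sum_fixWeight_sub_orbit hU hRinv hw
    simp only [Subgroup.card_bot] at e4
    have := sum_fixWeight_nonneg (U := fun _ : X => (⊥ : Subgroup G)) (S := Q)
    have hxY := hle x hxY
    push_cast at *
    omega
  rw [hR0, Finset.sum_empty] at e3
  have hy3 := card_orbit_mul_card_stabilizer' (G := G) y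
  have hz3 := card_orbit_mul_card_stabilizer' (G := G) z
  have hx6 : 6 * Nat.card (orbit G x) ≤ Nat.card G := by nlinarith
  have htot : Nat.card (orbit G x) + Nat.card (orbit G y) + Nat.card (orbit G z) =
      Nat.card G + 2 := by
    push_cast at *
    omega
  have aux : ∀ m a g : ℕ, m * a = g → 3 * m ≤ g ∨ g ≤ 2 * m := by
    intro m a g h
    rcases le_or_gt 3 a with h3 | h3
    · left; nlinarith
    · right; nlinarith
  have hy4 := aux _ _ _ hy3
  have hz4 := aux _ _ _ hz3
  omega

theorem eq_one_of_two_add_mul_eq {r e t k : ℕ} (hr : 2 ≤ r) (ht : 0 < t) (hdiv : e ∣ r + 1)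
    (hk : k ∣ 2) (h : 2 + (1 + (r + 2) * t) * r = k * ((r + 2) * e)) :
    t = 1 ∧ r + 1 ≤ 2 * e := by
  have hke : k * e = 1 + t * r := by
    have : (r + 2) * (k * e) = (r + 2) * (1 + t * r) := by linarith
    exact Nat.eq_of_mul_eq_mul_left (by omega) this
  have hle : e ≤ r + 1 := Nat.le_of_dvd (by omega) hdiv
  rcases (Nat.dvd_prime Nat.prime_two).1 hk with rfl | rfl
  · have : t = 1 := by
      by_contra hne
      have : 2 ≤ t := by omega
      nlinarith
    subst this
    omega
  · have : t ≤ 2 := by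
      by_contra hne
      have : 3 ≤ t := by omega
      nlinarith
    interval_cases t <;> omega

theorem card_orbit_of_unipotent {U : X → Subgroup G} {p : ℕ} [Fact p.Prime]
    (hU : IsUnipotentFamily U)
    (hfix : ∀ g : G, g ≠ 1 → (fixedBy X g).ncard = 1 ∨ (fixedBy X g).ncard = 2)
    (hp : ∀ x, IsPGroup p (U x))
    (hcomm : ∀ x, U x = ⊥ → ∀ g ∈ stabilizer G x, ∀ h ∈ stabilizer G x, g * h = h * g)
    {x : X} (hmove : ∃ g : G, g • x ≠ x) {q e : ℕ} (hq : Nat.card (U x) = q) (hq3 : 3 < q)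
    (he : Nat.card (stabilizer G x) = q * e) (hdiv : e ∣ q - 1) :
    Nat.card (orbit G x) = q + 1 ∧ q - 1 ≤ 2 * e := by
  obtain ⟨Y, hY, hsum⟩ := exists_sum_fixWeight hU hfix
  have hle : ∀ z ∈ Y, 2 * Nat.card (orbit G z) ≤ Nat.card G := by
    intro z hz
    obtain ⟨g, hg, hgz⟩ := (hY z).1 hz
    exact two_mul_card_orbit_le hg hgz
  have hYinv : ∀ (g : G), ∀ z ∈ Y, g • z ∈ Y := by
    intro g z hz
    obtain ⟨h, hh, hz⟩ := (hY z).1 hz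
    refine (hY _).2 ⟨g * h * g⁻¹, by simpa using hh, ?_⟩
    simp [mul_smul, hz]
  have horbfin : ∀ z : X, (orbit G z).Finite := fun z => Set.finite_range _
  -- orbits of `U z` away from `z` are regular
  have hfree : ∀ z w : X, z ∉ orbit G w → Nat.card (U z) ∣ Nat.card (orbit G w) := by
    intro z w hzw
    rw [Nat.card_coe_set_eq]
    refine card_dvd_ncard_of_free (horbfin w)
      (fun g y hy => (mem_orbit_of_mem_orbit (g : G) hy)) ?_
    intro g y hy hgy
    by_contra hg1
    exact hzw (hU.eq_of_smul_eq g.2 (fun h => hg1 (Subtype.ext h)) hgy ▸ hy)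
  have hfree' : ∀ z : X, Nat.card (U z) ∣ Nat.card (orbit G z) - 1 := by
    intro z
    rw [Nat.card_coe_set_eq, ← Set.ncard_sdiff_singleton_of_mem (mem_orbit_self (M := G) z)]
    refine card_dvd_ncard_of_free ((horbfin z).subset Set.sdiff_subset) ?_ ?_
    · intro g y hy
      refine ⟨mem_orbit_of_mem_orbit (g : G) hy.1, fun h => hy.2 ?_⟩
      have hz : (g : G) • z = z := hU.le_stabilizer z g.2
      exact smul_left_cancel (g : G) ((show (g : G) • y = z from h).trans hz.symm)
    · intro g y hy hgy
      by_contra hg1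
      exact hy.2 (hU.eq_of_smul_eq g.2 (fun h => hg1 (Subtype.ext h)) hgy)
  have hpU : ∀ z, U z ≠ ⊥ → p ∣ Nat.card (U z) := by
    intro z hz
    have : Nontrivial (U z) := (Subgroup.nontrivial_iff_ne_bot _).2 hz
    obtain ⟨n, hn0, hn⟩ := (hp z).nontrivial_iff_card.1 this
    rw [hn]
    exact dvd_pow_self p hn0.ne'
  have hUx : U x ≠ ⊥ := by
    intro h
    rw [h, Subgroup.card_bot] at hq
    omega
  have hUbot : ∀ z, z ∉ orbit G x → U z = ⊥ := by
    intro z hz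
    by_contra hne
    have hz' : x ∉ orbit G z := fun h => hz (mem_orbit_symm.1 h)
    have h1 := (hpU x hUx).trans (hfree x z hz')
    have h2 := (hpU z hne).trans (hfree' z)
    have h0 : 0 < Nat.card (orbit G z) :=
      have : Finite (orbit G z) := horbfin z
      have : Nonempty (orbit G z) := ⟨⟨z, mem_orbit_self z⟩⟩
      Nat.card_pos
    have h3 := (Nat.dvd_sub_iff_right h0 h1).1 h2
    exact (Fact.out : p.Prime).one_lt.ne' (Nat.dvd_one.1 h3)
  have hn := card_orbit_mul_card_stabilizer' (G := G) x
  have hn2 := two_le_card_orbit hmove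
  have hxY : x ∈ Y := by
    obtain ⟨g, hg, hg1⟩ := (U x).bot_or_exists_ne_one.resolve_left hUx
    exact (hY x).2 ⟨g, hg1, hU.le_stabilizer x hg⟩
  have he0 : 0 < e := by
    rcases Nat.eq_zero_or_pos e with h | h
    · have : 0 < Nat.card (stabilizer G x) := Nat.card_pos
      rw [he, h] at this
      simp at this
    · exact h
  rw [he] at hn
  set n := Nat.card (orbit G x) with hn_def
  obtain ⟨S, hS, hSinv, e1⟩ := exists_sum_fixWeight_sub_orbit hU hYinv hxY
  rw [hq, ← hn_def] at e1
  have hnq : n * q ≤ Nat.card G := by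
    rw [← hn]; nlinarith [Nat.mul_le_mul_left (n * q) he0]
  obtain ⟨y, hy⟩ := exists_mem_of_sum_fixWeight_pos (U := U) (S := S) (by
    zify at hnq hn2
    nlinarith)
  have hyx := ((hS y).1 hy).2
  have hyY := hle y ((hS y).1 hy).1
  obtain ⟨T, hT, hTinv, e2⟩ := exists_sum_fixWeight_sub_orbit hU hSinv hy
  rw [hUbot y hyx, Subgroup.card_bot] at e2
  have hT0 : T = ∅ := by
    by_contra hne
    obtain ⟨w, hw⟩ := Finset.nonempty_of_ne_empty hne
    have hwS := ((hT w).1 hw).1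
    have hwY := hle w ((hS w).1 hwS).1
    obtain ⟨Q, -, -, e3⟩ := exists_sum_fixWeight_sub_orbit hU hTinv hw
    rw [hUbot w ((hS w).1 hwS).2, Subgroup.card_bot] at e3
    have := sum_fixWeight_nonneg (U := U) (S := Q)
    zify at hwY hyY hq3 hn2
    push_cast at e2 e3
    nlinarith
  rw [hT0, Finset.sum_empty] at e2
  have hd := card_orbit_mul_card_stabilizer' (G := G) y
  set m := Nat.card (orbit G y)
  set d := Nat.card (stabilizer G y)
  have hm : (m : ℤ) = 2 + n * (q - 2) := by push_cast at e2; linarith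
  have hdn : d ∣ n := by
    rw [hn_def, Nat.card_coe_set_eq]
    refine card_dvd_ncard_of_free (G := stabilizer G y) (horbfin x)
      (fun g z hz => (mem_orbit_of_mem_orbit (g : G) hz)) ?_
    by_contra! hcon
    obtain ⟨⟨g, hgy⟩, z, hz, hgz, hg1⟩ := hcon
    have hg1 : g ≠ 1 := fun h => hg1 (Subtype.ext h)
    have hgz : g • z = z := hgz
    have hgy' : g • y = y := hgy
    have hzy : z ≠ y := fun h => hyx (h ▸ hz)
    have hfixg : fixedBy X g = {y, z} := by
      have hsub : ({y, z} : Set X) ⊆ fixedBy X g := by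
        rintro w (rfl | rfl)
        · exact hgy'
        · exact hgz
      refine (Set.eq_of_subset_of_ncard_le hsub ?_ ?_).symm
      · rw [Set.ncard_pair hzy.symm]
        have := hfix g hg1
        omega
      · apply Set.finite_of_ncard_ne_zero
        have := hfix g hg1
        omega
    have hstab : stabilizer G y ≤ stabilizer G z := by
      intro h hh
      have hgh : g • (h • z) = h • z := by
        rw [← mul_smul, hcomm y (hUbot y hyx) g hgy h hh, mul_smul, hgz]
      have hmem : h • z ∈ ({y, z} : Set X) := hfixg ▸ hgh
      rcases hmem with h1 | h1
      · have hh' : h • y = y := hh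
        rw [← hh'] at h1
        exact absurd (smul_left_cancel _ h1) hzy
      · exact h1
    obtain ⟨k, hk⟩ := id hz
    have hk : k • x = z := hk
    have hUz : Nat.card (U z) = q := by rw [← hk, hU.card_smul, hq]
    have hSz : Nat.card (stabilizer G z) = q * e := by
      rw [← hk, stabilizer_smul_eq_stabilizer_map_conj, ← he]
      exact (Nat.card_congr ((stabilizer G x).equivMapOfInjective (MulAut.conj k).toMonoidHom
          (MulAut.conj k).injective).toEquiv).symm
    have hdis : Disjoint (U z) (stabilizer G y) := by
      rw [Subgroup.disjoint_def]
      intro h h1 h2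
      by_contra hh1
      exact hzy (hU.eq_of_smul_eq h1 hh1 h2).symm
    have hcard : q * d ≤ q * e := by
      rw [← hSz, ← hUz, ← Nat.card_prod]
      refine Nat.card_le_card_of_injective (fun u : U z × stabilizer G y =>
        (⟨u.1 * u.2, mul_mem (hU.le_stabilizer z u.1.2) (hstab u.2.2)⟩ : stabilizer G z)) ?_
      intro u v huv
      exact Subgroup.mul_injective_of_disjoint hdis (congrArg Subtype.val huv)
    have hde : d ≤ e := Nat.le_of_mul_le_mul_left hcard (by omega)
    rw [← hn] at hd
    zify at hd hde hn2 hq3 he0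
    rw [hm] at hd
    nlinarith [mul_le_mul_of_nonneg_left hde (show (0:ℤ) ≤ 2 + n * (q - 2) by nlinarith)]
  obtain ⟨k, hk⟩ := hdn
  obtain ⟨r, rfl⟩ : ∃ r, q = r + 2 := ⟨q - 2, by omega⟩
  have hdvd : r + 2 ∣ n - 1 := hq ▸ hfree' x
  obtain ⟨t, ht⟩ := hdvd
  have hnt : n = 1 + (r + 2) * t := by omega
  have hm' : m = 2 + n * r := by
    zify; rw [hm]; push_cast; ring
  have hd0 : 0 < d := Nat.card_pos
  have key : 2 + n * r = k * ((r + 2) * e) := by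
    have : d * (2 + n * r) = d * (k * ((r + 2) * e)) := by
      rw [← hm', ← mul_assoc, ← hk, hn, mul_comm, hd]
    exact Nat.eq_of_mul_eq_mul_left hd0 this
  have hk2 : k ∣ 2 := by
    have h1 : k ∣ n * r := Dvd.dvd.mul_right ⟨d, by rw [hk, mul_comm]⟩ r
    exact (Nat.dvd_add_left h1).1 ⟨_, key⟩
  have ht0 : 0 < t := by
    rcases Nat.eq_zero_or_pos t with h | h
    · rw [h] at hnt; omega
    · exact h
  obtain ⟨rfl, h⟩ := eq_one_of_two_add_mul_eq (by omega) ht0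
    (by simpa using hdiv) hk2 (hnt ▸ key)
  omega

end Counting

theorem exists_mulEquiv_dihedralGroup {G : Type*} [Group G] {K : Subgroup G} [hK : IsCyclic K]
    (hindex : K.index = 2) (hinv : ∀ g ∉ K, g * g = 1) :
    ∃ n : ℕ, Nonempty (G ≃* DihedralGroup n) := by
  obtain ⟨s, hs⟩ : ∃ s, s ∉ K := by
    by_contra! h
    rw [(Subgroup.eq_top_iff' K).2 h, Subgroup.index_top] at hindex
    omega
  have hss := hinv s hs
  have hsk : ∀ k ∈ K, s * k ∉ K := fun k hk h => hs ((K.mul_mem_cancel_right hk).1 h)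
  have hconj : ∀ k ∈ K, k * s = s * k⁻¹ := by
    intro k hk
    have h := hinv _ (hsk k hk)
    have h2 : s * k * s = k⁻¹ := by rw [eq_inv_iff_mul_eq_one, ← h]; group
    rw [← h2, ← mul_assoc, ← mul_assoc, hss, one_mul]
  let e : Multiplicative (ZMod (Nat.card K)) ≃* K := zmodCyclicMulEquiv hK
  let c : ZMod (Nat.card K) → G := fun i => e (Multiplicative.ofAdd i)
  have hc : ∀ i, c i ∈ K := fun i => (e (Multiplicative.ofAdd i)).2
  have hadd : ∀ i j, c (i + j) = c i * c j := fun i j => by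
    simp only [c, ofAdd_add, map_mul, Subgroup.coe_mul]
  have hsub : ∀ i j, c (j - i) = (c i)⁻¹ * c j := fun i j => by
    rw [eq_inv_mul_iff_mul_eq, ← hadd, add_sub_cancel]
  have hc1 : ∀ i, c i = 1 → i = 0 := fun i hi => by simpa [c] using hi
  let F : DihedralGroup (Nat.card K) →* G := MonoidHom.mk'
    (fun | .r i => c i
         | .sr i => s * c i) (by
      rintro (i | i) (j | j)
      · exact hadd i j
      · change s * c (j - i) = c i * (s * c j)
        rw [hsub, ← mul_assoc, ← mul_assoc, hconj _ (hc i)]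
      · change s * c (i + j) = s * c i * c j
        rw [hadd, mul_assoc]
      · change c (j - i) = s * c i * (s * c j)
        rw [hsub, mul_assoc, ← mul_assoc (c i), hconj _ (hc i), ← mul_assoc, ← mul_assoc, hss,
          one_mul])
  refine ⟨Nat.card K, ⟨(MulEquiv.ofBijective F ⟨?_, ?_⟩).symm⟩⟩
  · rw [injective_iff_map_eq_one]
    rintro (i | i) h
    · rw [hc1 i h]; rfl
    · have h' : s * c i = 1 := h
      exact absurd (h' ▸ one_mem K) (hsk _ (hc i))
  · have hK' : ∀ g ∈ K, ∃ i, c i = g := fun g hg =>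
      ⟨(e.symm ⟨g, hg⟩).toAdd, by simp [c]⟩
    intro g
    by_cases hg : g ∈ K
    · obtain ⟨i, hi⟩ := hK' g hg
      exact ⟨.r i, hi⟩
    · obtain ⟨i, hi⟩ := hK' (s⁻¹ * g) (by
        rw [Subgroup.mul_mem_iff_of_index_two hindex, inv_mem_iff]
        exact iff_of_false hs hg)
      exact ⟨.sr i, by change s * c i = g; rw [hi, mul_inv_cancel_left]⟩

/-- The projective linear group `PGL₂`. -/
abbrev PGLTwo (L : Type*) [Field L] : Type _ :=
  GL (Fin 2) L ⧸ Subgroup.center (GL (Fin 2) L)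

namespace PGLTwo

open MulAction OnePoint

section ProjectiveLine

variable {L : Type*} [Field L]

/-- The projection `GL₂ → PGL₂`. -/
abbrev mk : GL (Fin 2) L →* PGLTwo L := QuotientGroup.mk' (Subgroup.center (GL (Fin 2) L))

theorem mk_eq_mk_of_smul {M N : GL (Fin 2) L} (c : L)
    (h : (N : Matrix (Fin 2) (Fin 2) L) = c • (M : Matrix (Fin 2) (Fin 2) L)) :
    mk M = mk N := by
  have hc : c ≠ 0 := by
    rintro rfl
    have := N.det_ne_zero
    rw [h] at this
    simp at this
  rw [QuotientGroup.mk'_eq_mk']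
  refine ⟨.scalar (Fin 2) (Units.mk0 c hc), ?_, ?_⟩
  · rw [Matrix.GeneralLinearGroup.center_eq_range_scalar]
    exact ⟨_, rfl⟩
  · ext i j
    rw [h]
    fin_cases i <;> fin_cases j <;> simp [Matrix.mul_apply, Fin.sum_univ_two, mul_comm]

open Classical in
/-- The action of `PGL₂` on the projective line by Möbius transformations. -/
noncomputable instance : MulAction (PGLTwo L) (OnePoint L) :=
  MulAction.compHom _ (QuotientGroup.lift (Subgroup.center (GL (Fin 2) L))
    (MulAction.toPermHom (GL (Fin 2) L) (OnePoint L)) (by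
      rw [Matrix.GeneralLinearGroup.center_eq_range_scalar]
      rintro _ ⟨u, rfl⟩
      rw [MonoidHom.mem_ker]
      ext x
      cases x with
      | infty => simp [smul_infty_eq_ite]
      | coe x => simp [smul_some_eq_ite]))

open Classical in
theorem mk_smul (M : GL (Fin 2) L) (x : OnePoint L) : mk M • x = M • x := rfl

theorem mk_smul_infty_eq_infty {M : GL (Fin 2) L} : mk M • (∞ : OnePoint L) = ∞ ↔ M 1 0 = 0 := by
  classical
  rw [mk_smul]
  convert smul_infty_eq_self_iff (g := M)

theorem mk_smul_infty {M : GL (Fin 2) L} (h : M 1 0 ≠ 0) :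
    mk M • (∞ : OnePoint L) = ((M 0 0 / M 1 0 : L) : OnePoint L) := by
  classical
  rw [mk_smul, smul_infty_eq_ite, if_neg h]

theorem mk_smul_coe {M : GL (Fin 2) L} {k : L} (h : M 1 0 * k + M 1 1 ≠ 0) :
    mk M • (k : OnePoint L) = (((M 0 0 * k + M 0 1) / (M 1 0 * k + M 1 1) : L) : OnePoint L) := by
  classical
  rw [mk_smul, smul_some_eq_ite, if_neg h]

theorem mk_smul_coe_eq_infty {M : GL (Fin 2) L} {k : L} (h : M 1 0 * k + M 1 1 = 0) :
    mk M • (k : OnePoint L) = ∞ := by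
  classical
  rw [mk_smul, smul_some_eq_ite, if_pos h]

/-- The affine transformation `x ↦ u * x + b`. -/
noncomputable def affine (u : Lˣ) (b : L) : PGLTwo L :=
  mk (Matrix.GeneralLinearGroup.mkOfDetNeZero !![(u : L), b; 0, 1] (by simp [det_fin_two]))

/-- The transformation `x ↦ x⁻¹`. -/
noncomputable def inversion : PGLTwo L :=
  mk (Matrix.GeneralLinearGroup.mkOfDetNeZero !![0, 1; 1, 0] (by simp [det_fin_two]))

@[simp]
theorem affine_smul_infty (u : Lˣ) (b : L) : affine u b • (∞ : OnePoint L) = ∞ := by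
  rw [affine, mk_smul_infty_eq_infty]
  simp [Matrix.GeneralLinearGroup.mkOfDetNeZero]

@[simp]
theorem affine_smul_coe (u : Lˣ) (b x : L) :
    affine u b • (x : OnePoint L) = ((u * x + b : L) : OnePoint L) := by
  rw [affine, mk_smul_coe] <;> simp [Matrix.GeneralLinearGroup.mkOfDetNeZero]

@[simp]
theorem inversion_smul_infty :
    (inversion : PGLTwo L) • (∞ : OnePoint L) = ((0 : L) : OnePoint L) := by
  rw [inversion, mk_smul_infty] <;> simp [Matrix.GeneralLinearGroup.mkOfDetNeZero]

@[simp]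
theorem inversion_smul_zero : (inversion : PGLTwo L) • ((0 : L) : OnePoint L) = ∞ := by
  rw [inversion, mk_smul_coe_eq_infty]; simp [Matrix.GeneralLinearGroup.mkOfDetNeZero]

theorem affine_mul (u v : Lˣ) (b c : L) :
    affine u b * affine v c = affine (u * v) (u * c + b) := by
  rw [affine, affine, affine, ← map_mul]
  congr 1
  ext i j
  fin_cases i <;> fin_cases j <;>
    simp [Matrix.GeneralLinearGroup.mkOfDetNeZero, Matrix.mul_apply, Fin.sum_univ_two]

@[simp]
theorem affine_one_zero : affine (1 : Lˣ) 0 = 1 := by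
  rw [affine, ← map_one mk]
  congr 1
  ext i j
  fin_cases i <;> fin_cases j <;> simp [Matrix.GeneralLinearGroup.mkOfDetNeZero]

theorem affine_injective {u v : Lˣ} {b c : L} (h : affine u b = affine v c) : u = v ∧ b = c := by
  have h0 := congrArg (fun g => g • ((0 : L) : OnePoint L)) h
  have h1 := congrArg (fun g => g • ((1 : L) : OnePoint L)) h
  simp only [affine_smul_coe, OnePoint.coe_eq_coe, mul_zero, zero_add, mul_one] at h0 h1
  rw [h0] at h1
  exact ⟨Units.ext (add_right_cancel h1), h0⟩

theorem exists_eq_affine {g : PGLTwo L} (h : g • (∞ : OnePoint L) = ∞) :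
    ∃ u b, g = affine u b := by
  obtain ⟨M, rfl⟩ := QuotientGroup.mk'_surjective _ g
  have h10 : M 1 0 = 0 := mk_smul_infty_eq_infty.1 h
  have hdet := M.det_ne_zero
  rw [det_fin_two, h10, mul_zero, sub_zero] at hdet
  have h0 := left_ne_zero_of_mul hdet
  have h1 := right_ne_zero_of_mul hdet
  refine ⟨Units.mk0 (M 0 0 / M 1 1) (div_ne_zero h0 h1), M 0 1 / M 1 1, ?_⟩
  refine mk_eq_mk_of_smul (M 1 1)⁻¹ ?_
  ext i j
  fin_cases i <;> fin_cases j <;>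
    simp [Matrix.GeneralLinearGroup.mkOfDetNeZero, h10, h1, div_eq_inv_mul]

theorem exists_smul_eq_infty (x : OnePoint L) : ∃ g : PGLTwo L, g • x = ∞ := by
  cases x with
  | infty => exact ⟨1, one_smul _ _⟩
  | coe a => exact ⟨inversion * affine 1 (-a), by simp [mul_smul]⟩

theorem exists_smul_eq_infty_zero {x y : OnePoint L} (h : y ≠ x) :
    ∃ g : PGLTwo L, g • x = ∞ ∧ g • y = (0 : L) := by
  obtain ⟨g, hg⟩ := exists_smul_eq_infty x
  have hy : g • y ≠ ∞ := fun h' => h (smul_left_cancel g (h'.trans hg.symm))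
  obtain ⟨a, ha⟩ := OnePoint.ne_infty_iff_exists.1 hy
  exact ⟨affine 1 (-a) * g, by simp [mul_smul, hg], by simp [mul_smul, ← ha]⟩

theorem exists_smul_eq_infty_zero_one {x y z : OnePoint L} (h : y ≠ x) (hz : z ≠ x)
    (hzy : z ≠ y) : ∃ g : PGLTwo L, g • x = ∞ ∧ g • y = (0 : L) ∧ g • z = (1 : L) := by
  obtain ⟨g, hx, hy⟩ := exists_smul_eq_infty_zero h
  have hz' : g • z ≠ ∞ := fun h' => hz (smul_left_cancel g (h'.trans hx.symm))
  obtain ⟨a, ha⟩ := OnePoint.ne_infty_iff_exists.1 hz'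
  have ha0 : a ≠ 0 := by
    rintro rfl
    exact hzy (smul_left_cancel g (ha.symm.trans hy.symm))
  exact ⟨affine (Units.mk0 a ha0)⁻¹ 0 * g, by simp [mul_smul, hx], by simp [mul_smul, hy],
    by simp [mul_smul, ← ha, ha0]⟩

/-- The group of translations, i.e. the unipotent radical of the stabilizer of `∞`. -/
noncomputable def translations (L : Type*) [Field L] : Subgroup (PGLTwo L) where
  carrier := Set.range fun b : L => affine 1 b
  mul_mem' := by
    rintro _ _ ⟨b, rfl⟩ ⟨c, rfl⟩
    exact ⟨c + b, by simp [affine_mul]⟩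
  one_mem' := ⟨0, affine_one_zero⟩
  inv_mem' := by
    rintro _ ⟨b, rfl⟩
    refine ⟨-b, ?_⟩
    rw [eq_inv_iff_mul_eq_one]
    simp [affine_mul]

theorem mem_translations {g : PGLTwo L} : g ∈ translations L ↔ ∃ b, affine 1 b = g := Iff.rfl

theorem fixedBy_affine_one {b : L} (hb : b ≠ 0) :
    fixedBy (OnePoint L) (affine 1 b) = {∞} := by
  ext x
  cases x with
  | infty => simp
  | coe x => simp [hb]

theorem fixedBy_affine {u : Lˣ} (hu : u ≠ 1) (b : L) :
    fixedBy (OnePoint L) (affine u b) = {∞, ((b / (1 - u) : L) : OnePoint L)} := by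
  have hu' : (1 : L) - u ≠ 0 := by
    rw [sub_ne_zero]
    exact fun h => hu (Units.ext h.symm)
  ext x
  cases x with
  | infty => simp
  | coe x =>
    simp only [mem_fixedBy, affine_smul_coe, OnePoint.coe_eq_coe, Set.mem_insert_iff,
      OnePoint.coe_ne_infty, Set.mem_singleton_iff, false_or, eq_div_iff hu']
    constructor <;> intro h <;> linear_combination -h

theorem mem_translations_iff_fixedBy {g : PGLTwo L} :
    g ∈ translations L ↔ g = 1 ∨ fixedBy (OnePoint L) g = {∞} := by
  rw [mem_translations]
  constructor
  · rintro ⟨b, rfl⟩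
    by_cases hb : b = 0
    · left; rw [hb, affine_one_zero]
    · exact Or.inr (fixedBy_affine_one hb)
  · rintro (rfl | h)
    · exact ⟨0, affine_one_zero⟩
    · obtain ⟨u, b, rfl⟩ := exists_eq_affine
        (show (∞ : OnePoint L) ∈ fixedBy (OnePoint L) g from h ▸ Set.mem_singleton _)
      by_cases hu : u = 1
      · exact ⟨b, by rw [hu]⟩
      · rw [fixedBy_affine hu] at h
        have : ((b / (1 - u) : L) : OnePoint L) ∈ ({∞} : Set (OnePoint L)) := by
          rw [← h]; simp
        simp at this

/-- The unipotent elements of `PGL₂` fixing a given point of the projective line. -/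
noncomputable def unipotents (x : OnePoint L) : Subgroup (PGLTwo L) :=
  (translations L).comap (MulAut.conj (exists_smul_eq_infty x).choose).toMonoidHom

open scoped Pointwise in
theorem isUnipotentFamily_unipotents :
    IsUnipotentFamily (unipotents : OnePoint L → Subgroup (PGLTwo L)) := by
  intro x g
  rw [unipotents, Subgroup.mem_comap]
  set k := (exists_smul_eq_infty x).choose
  have hk : k • x = ∞ := (exists_smul_eq_infty x).choose_spec
  change k * g * k⁻¹ ∈ _ ↔ _
  rw [mem_translations_iff_fixedBy, ← smul_fixedBy, ← hk, ← Set.smul_set_singleton,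
    smul_left_cancel_iff]
  refine or_congr ?_ Iff.rfl
  rw [conj_eq_one_iff]

theorem unipotents_infty : unipotents (∞ : OnePoint L) = translations L := by
  ext g
  rw [isUnipotentFamily_unipotents, mem_translations_iff_fixedBy]

theorem pow_eq_one_of_mem_unipotents {p : ℕ} [CharP L p] {x : OnePoint L} {g : PGLTwo L}
    (hg : g ∈ unipotents x) : g ^ p = 1 := by
  obtain ⟨b, hb⟩ := hg
  have hpow : ∀ n : ℕ, (affine 1 b) ^ n = affine 1 (n * b) := by
    intro n
    induction n with
    | zero => simp
    | succ n ih =>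
      rw [pow_succ, ih, affine_mul]
      congr 1
      · simp
      · push_cast; ring
  have h := hpow p
  rw [CharP.cast_eq_zero, zero_mul, affine_one_zero] at h
  have hb' : affine 1 b = MulAut.conj (exists_smul_eq_infty x).choose g := hb
  rw [hb', ← map_pow] at h
  simpa using h

theorem exists_smul_eq [IsAlgClosed L] (g : PGLTwo L) : ∃ x : OnePoint L, g • x = x := by
  classical
  obtain ⟨M, rfl⟩ := QuotientGroup.mk'_surjective _ g
  by_cases h : M 1 0 = 0
  · exact ⟨∞, mk_smul_infty_eq_infty.2 h⟩
  have hdeg : (Polynomial.C (M 1 0) * Polynomial.X ^ 2 +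
      Polynomial.C (M 1 1 - M 0 0) * Polynomial.X + Polynomial.C (-M 0 1)).degree ≠ 0 := by
    rw [Polynomial.degree_quadratic h]; decide
  obtain ⟨c, hc⟩ := IsAlgClosed.exists_root _ hdeg
  refine ⟨c, ?_⟩
  have hc : M 1 0 * c ^ 2 + (M 1 1 - M 0 0) * c - M 0 1 = 0 := by
    simpa [Polynomial.IsRoot, sub_eq_add_neg] using hc
  have hdet := M.det_ne_zero
  rw [det_fin_two] at hdet
  have h2 : M 1 0 * c + M 1 1 ≠ 0 := by
    intro h2
    apply hdet
    have : M 0 0 * c + M 0 1 = 0 := by linear_combination c * h2 - hc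
    have h3 : M 1 0 * (M 0 0 * M 1 1 - M 0 1 * M 1 0) = 0 := by
      linear_combination (M 1 0 * M 0 0) * h2 - M 1 0 * M 1 0 * this
    exact (mul_eq_zero.1 h3).resolve_left h
  rw [mk_smul_coe h2, OnePoint.coe_eq_coe, div_eq_iff h2]
  linear_combination -hc

open scoped Pointwise in
theorem ncard_fixedBy [IsAlgClosed L] {g : PGLTwo L} (hg : g ≠ 1) :
    (fixedBy (OnePoint L) g).ncard = 1 ∨ (fixedBy (OnePoint L) g).ncard = 2 := by
  obtain ⟨x, hx⟩ := exists_smul_eq g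
  obtain ⟨k, hk⟩ := exists_smul_eq_infty x
  have hfix : (k * g * k⁻¹) • (∞ : OnePoint L) = ∞ := by
    rw [← hk]; simp [mul_smul, hx]
  have hcard : (fixedBy (OnePoint L) (k * g * k⁻¹)).ncard = (fixedBy (OnePoint L) g).ncard := by
    rw [← smul_fixedBy, Set.ncard_smul_set]
  rw [← hcard]
  obtain ⟨u, b, hub⟩ := exists_eq_affine hfix
  rw [hub]
  by_cases hu : u = 1
  · subst hu
    have hb : b ≠ 0 := by
      rintro rfl
      rw [affine_one_zero, conj_eq_one_iff] at hub
      exact hg hub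
    rw [fixedBy_affine_one hb, Set.ncard_singleton]
    exact Or.inl rfl
  · rw [fixedBy_affine hu, Set.ncard_pair (by simp)]
    exact Or.inr rfl

/-- The linear part of the elements of `PGL₂` fixing `∞`. -/
noncomputable def multiplier : stabilizer (PGLTwo L) (∞ : OnePoint L) →* Lˣ :=
  MonoidHom.mk' (fun g => (exists_eq_affine g.2).choose) (by
    intro g h
    obtain ⟨b, hb⟩ := (exists_eq_affine g.2).choose_spec
    obtain ⟨c, hc⟩ := (exists_eq_affine h.2).choose_spec
    obtain ⟨d, hd⟩ := (exists_eq_affine (g * h).2).choose_spec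
    have hgh := congrArg₂ (· * ·) hb hc
    rw [affine_mul] at hgh
    exact (affine_injective (hd.symm.trans hgh)).1)

theorem multiplier_eq {g : stabilizer (PGLTwo L) (∞ : OnePoint L)} {u : Lˣ} {b : L}
    (h : (g : PGLTwo L) = affine u b) : multiplier g = u := by
  obtain ⟨c, hc⟩ := (exists_eq_affine g.2).choose_spec
  exact (affine_injective (hc.symm.trans h)).1

theorem multiplier_eq_one_iff {g : stabilizer (PGLTwo L) (∞ : OnePoint L)} :
    multiplier g = 1 ↔ (g : PGLTwo L) ∈ translations L := by
  obtain ⟨u, b, h⟩ := exists_eq_affine g.2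
  rw [multiplier_eq h, h, mem_translations]
  exact ⟨fun hu => ⟨b, by rw [hu]⟩, fun ⟨c, hc⟩ => (affine_injective hc).1.symm⟩

open scoped Pointwise in
theorem commutator_mem_unipotents {x : OnePoint L} {g h : PGLTwo L} (hg : g • x = x)
    (hh : h • x = x) : g * h * g⁻¹ * h⁻¹ ∈ unipotents x := by
  obtain ⟨k, hk⟩ := exists_smul_eq_infty x
  have hk' : k⁻¹ • (∞ : OnePoint L) = x := by rw [← hk, inv_smul_smul]
  let G : stabilizer (PGLTwo L) (∞ : OnePoint L) := ⟨k * g * k⁻¹, by simp [mul_smul, hk', hg, hk]⟩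
  let H : stabilizer (PGLTwo L) (∞ : OnePoint L) := ⟨k * h * k⁻¹, by simp [mul_smul, hk', hh, hk]⟩
  have h1 : multiplier (G * H * G⁻¹ * H⁻¹) = 1 := by
    simp only [map_mul, map_inv]
    rw [mul_comm (multiplier G) (multiplier H)]; simp
  rw [multiplier_eq_one_iff] at h1
  have h2 : ((G * H * G⁻¹ * H⁻¹ : stabilizer (PGLTwo L) (∞ : OnePoint L)) : PGLTwo L) =
      k * (g * h * g⁻¹ * h⁻¹) * k⁻¹ := by
    simp only [Subgroup.coe_mul, Subgroup.coe_inv, G, H]; group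
  rw [h2, mem_translations_iff_fixedBy, ← smul_fixedBy, ← hk, ← Set.smul_set_singleton,
    smul_left_cancel_iff, conj_eq_one_iff] at h1
  exact (isUnipotentFamily_unipotents _ _).2 h1

end ProjectiveLine

section Subfield

variable {K L : Type*} [Field K] [Field L]

/-- The image of `GL₂(K)` in `PGL₂(L)` under a field embedding `K → L`. -/
abbrev projGL (f : K →+* L) : Subgroup (PGLTwo L) :=
  ((QuotientGroup.mk' (Subgroup.center (GL (Fin 2) L))).comp
    (Units.map (RingHom.mapMatrix f).toMonoidHom)).range

/-- The image of `SL₂(K)` in `PGL₂(L)` under a field embedding `K → L`. -/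
abbrev projSL (f : K →+* L) : Subgroup (PGLTwo L) :=
  ((QuotientGroup.mk' (Subgroup.center (GL (Fin 2) L))).comp
    ((Units.map (RingHom.mapMatrix f).toMonoidHom).comp
      Matrix.SpecialLinearGroup.toGL)).range

variable (f : K →+* L)

theorem affine_mem_projGL (u : Kˣ) (b : K) : affine (Units.map f u) (f b) ∈ projGL f := by
  refine ⟨Matrix.GeneralLinearGroup.mkOfDetNeZero !![(u : K), b; 0, 1] (by simp [det_fin_two]), ?_⟩
  refine congrArg mk ?_
  ext i j
  fin_cases i <;> fin_cases j <;> simp [Matrix.GeneralLinearGroup.mkOfDetNeZero]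

theorem inversion_mem_projGL : inversion ∈ projGL f := by
  refine ⟨Matrix.GeneralLinearGroup.mkOfDetNeZero !![0, 1; 1, 0] (by simp [det_fin_two]), ?_⟩
  refine congrArg mk ?_
  ext i j
  fin_cases i <;> fin_cases j <;> simp [Matrix.GeneralLinearGroup.mkOfDetNeZero]

variable {f}

theorem smul_mem_range_map {g : PGLTwo L} (hg : g ∈ projGL f) {x : OnePoint L}
    (hx : x ∈ Set.range (OnePoint.map f)) : g • x ∈ Set.range (OnePoint.map f) := by
  classical
  obtain ⟨M, rfl⟩ := hg
  obtain ⟨y, rfl⟩ := hx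
  refine ⟨M • y, ?_⟩
  rw [OnePoint.map_smul, MonoidHom.comp_apply, mk_smul]
  convert rfl
  rfl

theorem mem_projGL_of_smul_infty {g : PGLTwo L} (h : g • (∞ : OnePoint L) = ∞)
    (h0 : g • ((0 : L) : OnePoint L) ∈ Set.range (OnePoint.map f))
    (h1 : g • ((1 : L) : OnePoint L) ∈ Set.range (OnePoint.map f)) : g ∈ projGL f := by
  obtain ⟨u, b, rfl⟩ := exists_eq_affine h
  rw [affine_smul_coe] at h0 h1
  obtain ⟨y, hy⟩ := h0
  obtain ⟨z, hz⟩ := h1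
  cases y with
  | infty => simp at hy
  | coe y =>
  cases z with
  | infty => simp at hz
  | coe z =>
  rw [OnePoint.map_some, OnePoint.coe_eq_coe] at hy hz
  have hu : (u : L) = f (z - y) := by rw [map_sub, hy, hz]; ring
  have hzy : z - y ≠ 0 := by
    intro h
    rw [h, map_zero] at hu
    exact u.ne_zero hu
  have hb : b = f y := by rw [hy]; ring
  have hu' : u = Units.map f (Units.mk0 (z - y) hzy) := Units.ext (by simpa using hu)
  rw [hb, hu']
  exact affine_mem_projGL f _ _

theorem mem_projGL {g : PGLTwo L} (h : g • (∞ : OnePoint L) ∈ Set.range (OnePoint.map f))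
    (h0 : g • ((0 : L) : OnePoint L) ∈ Set.range (OnePoint.map f))
    (h1 : g • ((1 : L) : OnePoint L) ∈ Set.range (OnePoint.map f)) : g ∈ projGL f := by
  obtain ⟨a, ha⟩ := h
  obtain ⟨k, hk, hka⟩ : ∃ k ∈ projGL f, k • (OnePoint.map f a) = ∞ := by
    cases a with
    | infty => exact ⟨1, one_mem _, by simp⟩
    | coe a =>
      refine ⟨inversion * affine 1 (f (-a)), mul_mem (inversion_mem_projGL f) ?_, ?_⟩
      · simpa using affine_mem_projGL f 1 (-a)
      · simp [mul_smul]
  have hkg : k * g ∈ projGL f := by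
    apply mem_projGL_of_smul_infty
    · rw [mul_smul, ← ha, hka]
    · rw [mul_smul]; exact smul_mem_range_map hk h0
    · rw [mul_smul]; exact smul_mem_range_map hk h1
  exact (Subgroup.mul_mem_cancel_left _ hk).1 hkg

theorem projSL_le {H : Subgroup (PGLTwo L)} (hu : ∀ a : K, affine 1 (f a) ∈ H)
    (hl : ∀ a : K, inversion * affine 1 (f a) * inversion ∈ H) : projSL f ≤ H := by
  set φ := (QuotientGroup.mk' (Subgroup.center (GL (Fin 2) L))).comp
    ((Units.map (RingHom.mapMatrix f).toMonoidHom).comp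
      (Matrix.SpecialLinearGroup.toGL (n := Fin 2))) with hφ
  let up : K → SpecialLinearGroup (Fin 2) K := fun a => ⟨!![1, a; 0, 1], by simp [det_fin_two]⟩
  let lo : K → SpecialLinearGroup (Fin 2) K := fun a => ⟨!![1, 0; a, 1], by simp [det_fin_two]⟩
  have coe_up : ∀ a, (up a : Matrix (Fin 2) (Fin 2) K) = !![1, a; 0, 1] := fun _ => rfl
  have coe_lo : ∀ a, (lo a : Matrix (Fin 2) (Fin 2) K) = !![1, 0; a, 1] := fun _ => rfl
  clear_value up lo
  have hup : ∀ a, φ (up a) ∈ H := by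
    intro a
    convert hu a using 1
    refine congrArg mk ?_
    ext i j
    change f ((up a : Matrix (Fin 2) (Fin 2) K) i j) = _
    rw [coe_up]
    fin_cases i <;> fin_cases j <;> simp [Matrix.GeneralLinearGroup.mkOfDetNeZero]
  have hlo : ∀ a, φ (lo a) ∈ H := by
    intro a
    convert hl a using 1
    rw [inversion, affine, ← map_mul, ← map_mul]
    refine congrArg mk ?_
    ext i j
    change f ((lo a : Matrix (Fin 2) (Fin 2) K) i j) = _
    rw [coe_lo]
    fin_cases i <;> fin_cases j <;>
      simp [Matrix.GeneralLinearGroup.mkOfDetNeZero, Matrix.mul_apply, Fin.sum_univ_two]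
  have key : ∀ S : SpecialLinearGroup (Fin 2) K, S 1 0 ≠ 0 → φ S ∈ H := by
    intro S hS
    have hdet := S.det_coe
    rw [det_fin_two] at hdet
    have : S = up ((S 0 0 - 1) / S 1 0) * lo (S 1 0) * up ((S 1 1 - 1) / S 1 0) := by
      ext i j
      fin_cases i <;> fin_cases j <;>
        simp [coe_up, coe_lo, Matrix.mul_apply, Fin.sum_univ_two] <;> field_simp
      · ring
      · linear_combination -hdet
      · ring
    rw [this, map_mul, map_mul]
    exact mul_mem (mul_mem (hup _) (hlo _)) (hup _)
  rintro _ ⟨S, rfl⟩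
  by_cases hS : S 1 0 = 0
  · have hdet := S.det_coe
    rw [det_fin_two, hS] at hdet
    have h00 : S 0 0 ≠ 0 := by
      intro h
      rw [h] at hdet
      simp at hdet
    have := key (lo 1 * S) (by simp [coe_lo, Matrix.mul_apply, Fin.sum_univ_two, hS, h00])
    rw [map_mul] at this
    exact (Subgroup.mul_mem_cancel_left _ (hlo 1)).1 this
  · exact key S hS

theorem mem_projSL_of_isSquare_det {M : GL (Fin 2) K}
    (hM : IsSquare (M : Matrix (Fin 2) (Fin 2) K).det) :
    mk (Units.map (RingHom.mapMatrix f).toMonoidHom M) ∈ projSL f := by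
  obtain ⟨r, hr⟩ := hM
  have hdet := M.det_ne_zero
  have hr0 : r ≠ 0 := by
    rintro rfl
    rw [hr] at hdet
    simp at hdet
  refine ⟨⟨r⁻¹ • (M : Matrix (Fin 2) (Fin 2) K), ?_⟩, ?_⟩
  · rw [det_smul, hr, Fintype.card_fin]
    field_simp
  · refine mk_eq_mk_of_smul (f r) ?_
    ext i j
    change f ((M : Matrix (Fin 2) (Fin 2) K) i j) =
      f r * f (r⁻¹ * (M : Matrix (Fin 2) (Fin 2) K) i j)
    rw [← map_mul, mul_inv_cancel_left₀ hr0]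

theorem isSquare_mul_of_not_isSquare {F : Type*} [Field F] [Finite F] {a b : F}
    (ha : ¬ IsSquare a) (hb : ¬ IsSquare b) : IsSquare (a * b) := by
  classical
  have := Fintype.ofFinite F
  have ha0 : a ≠ 0 := by rintro rfl; exact ha (IsSquare.zero)
  have hb0 : b ≠ 0 := by rintro rfl; exact hb (IsSquare.zero)
  have hF : ringChar F ≠ 2 := fun h => ha (FiniteField.isSquare_of_char_two h a)
  rw [← quadraticChar_one_iff_isSquare (mul_ne_zero ha0 hb0), map_mul,
    quadraticChar_neg_one_iff_not_isSquare.2 ha, quadraticChar_neg_one_iff_not_isSquare.2 hb]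
  rfl

theorem eq_projSL_or_eq_projGL [Finite K] {H : Subgroup (PGLTwo L)} (h1 : projSL f ≤ H)
    (h2 : H ≤ projGL f) : H = projSL f ∨ H = projGL f := by
  by_cases h : H ≤ projSL f
  · exact Or.inl (le_antisymm h h1)
  right
  refine le_antisymm h2 ?_
  obtain ⟨x, hx, hxS⟩ := SetLike.not_le_iff_exists.1 h
  obtain ⟨M, rfl⟩ := h2 hx
  have hM : ¬ IsSquare (M : Matrix (Fin 2) (Fin 2) K).det :=
    fun hM => hxS (mem_projSL_of_isSquare_det hM)
  rintro _ ⟨N, rfl⟩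
  by_cases hN : IsSquare (N : Matrix (Fin 2) (Fin 2) K).det
  · exact h1 (mem_projSL_of_isSquare_det hN)
  · have hMN := h1 (mem_projSL_of_isSquare_det (f := f) (M := M * N) (by
      rw [Units.val_mul, det_mul]
      exact isSquare_mul_of_not_isSquare hM hN))
    rw [map_mul, map_mul] at hMN
    exact (Subgroup.mul_mem_cancel_left _ hx).1 hMN

end Subfield

section Unipotent

variable {L : Type*} [Field L] (H : Subgroup (PGLTwo L))

theorem isUnipotentFamily_subgroupOf :
    IsUnipotentFamily fun x : OnePoint L => (unipotents x).subgroupOf H := by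
  intro x g
  rw [Subgroup.mem_subgroupOf, isUnipotentFamily_unipotents]
  exact or_congr (by simp) Iff.rfl

theorem isPGroup_unipotents_subgroupOf (p : ℕ) [CharP L p] (x : OnePoint L) :
    IsPGroup p ((unipotents x).subgroupOf H) := by
  rintro ⟨g, hg⟩
  refine ⟨1, ?_⟩
  rw [pow_one]
  ext
  exact pow_eq_one_of_mem_unipotents (Subgroup.mem_subgroupOf.1 hg)

variable {H} in
theorem mul_comm_of_unipotents_subgroupOf_eq_bot {x : OnePoint L}
    (hx : (unipotents x).subgroupOf H = ⊥) {g h : H} (hg : g ∈ stabilizer H x)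
    (hh : h ∈ stabilizer H x) : g * h = h * g := by
  have key : g * h * g⁻¹ * h⁻¹ ∈ (unipotents x).subgroupOf H :=
    commutator_mem_unipotents (g := (g : PGLTwo L)) (h := (h : PGLTwo L)) hg hh
  rw [hx, Subgroup.mem_bot] at key
  rwa [mul_inv_eq_one, mul_inv_eq_iff_eq_mul] at key

/-- The additive group of translation lengths of the translations in `H`. -/
noncomputable def translationLengths : AddSubgroup L where
  carrier := {a | affine 1 a ∈ H}
  add_mem' {a b} ha hb := by
    have := H.mul_mem ha hb
    rw [affine_mul] at this
    simpa [add_comm] using this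
  zero_mem' := by simp
  neg_mem' {a} ha := by
    have : (affine 1 a)⁻¹ = affine (1 : Lˣ) (-a) := by
      rw [inv_eq_iff_mul_eq_one]
      simp [affine_mul]
    rw [Set.mem_ofPred_eq, ← this]
    exact H.inv_mem ha

variable {H} in
theorem mem_translationLengths {a : L} : a ∈ translationLengths H ↔ affine 1 a ∈ H := Iff.rfl

theorem card_translationLengths :
    Nat.card (translationLengths H) = Nat.card ((unipotents (∞ : OnePoint L)).subgroupOf H) := by
  refine Nat.card_congr (Equiv.ofBijective (fun a => ⟨⟨affine 1 a, a.2⟩, ?_⟩) ⟨?_, ?_⟩)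
  · rw [Subgroup.mem_subgroupOf, unipotents_infty]
    exact ⟨_, rfl⟩
  · intro a b hab
    have : affine 1 (a : L) = affine 1 (b : L) := congrArg (fun x => x.1.1) hab
    exact Subtype.ext (affine_injective this).2
  · rintro ⟨⟨g, hg⟩, hgU⟩
    rw [Subgroup.mem_subgroupOf, unipotents_infty] at hgU
    obtain ⟨b, rfl⟩ := hgU
    exact ⟨⟨b, hg⟩, rfl⟩

/-- The linear part of the elements of `H` fixing `∞`. -/
noncomputable def subgroupMultiplier : stabilizer H (∞ : OnePoint L) →* Lˣ :=
  multiplier.comp ((H.subtype.comp (stabilizer H (∞ : OnePoint L)).subtype).codRestrict _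
    fun g => g.2)

variable {H}

theorem subgroupMultiplier_eq {g : stabilizer H (∞ : OnePoint L)} {u : Lˣ} {b : L}
    (h : (g : PGLTwo L) = affine u b) : subgroupMultiplier H g = u :=
  multiplier_eq h

theorem mem_range_subgroupMultiplier {u : Lˣ} :
    u ∈ (subgroupMultiplier H).range ↔ ∃ b, affine u b ∈ H := by
  constructor
  · rintro ⟨g, rfl⟩
    obtain ⟨v, b, h⟩ := exists_eq_affine g.2
    rw [subgroupMultiplier_eq h]
    exact ⟨b, h ▸ g.1.2⟩
  · rintro ⟨b, hb⟩
    exact ⟨⟨⟨_, hb⟩, affine_smul_infty u b⟩, subgroupMultiplier_eq rfl⟩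

theorem subgroupMultiplier_eq_one_iff {g : stabilizer H (∞ : OnePoint L)} :
    subgroupMultiplier H g = 1 ↔ (g : PGLTwo L) ∈ translations L :=
  multiplier_eq_one_iff

theorem card_stabilizer_infty : Nat.card (stabilizer H (∞ : OnePoint L)) =
    Nat.card (translationLengths H) * Nat.card (subgroupMultiplier H).range := by
  rw [← Subgroup.card_mul_index (subgroupMultiplier H).ker, Subgroup.index_ker,
    card_translationLengths]
  congr 1
  refine Nat.card_congr ⟨fun g => ⟨g.1.1, ?_⟩, fun g => ⟨⟨g.1, ?_⟩, ?_⟩, fun _ => rfl, fun _ => rfl⟩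
  · rw [Subgroup.mem_subgroupOf, unipotents_infty]
    exact subgroupMultiplier_eq_one_iff.1 g.2
  · exact (isUnipotentFamily_subgroupOf H).le_stabilizer _ g.2
  · rw [MonoidHom.mem_ker, subgroupMultiplier_eq_one_iff, ← unipotents_infty]
    exact Subgroup.mem_subgroupOf.1 g.2

theorem mul_mem_translationLengths {u : Lˣ} (hu : u ∈ (subgroupMultiplier H).range) {a : L}
    (ha : a ∈ translationLengths H) : u * a ∈ translationLengths H := by
  obtain ⟨b, hb⟩ := mem_range_subgroupMultiplier.1 hu
  have : affine u b * affine 1 a * (affine u b)⁻¹ = affine 1 (u * a) := by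
    rw [mul_inv_eq_iff_eq_mul, affine_mul, affine_mul]
    simp [add_comm]
  rw [mem_translationLengths, ← this]
  exact H.mul_mem (H.mul_mem hb ha) (H.inv_mem hb)

variable (H) in
theorem finite_translationLengths [Finite H] : (translationLengths H : Set L).Finite :=
  Set.Finite.of_injOn (f := fun a : L => affine 1 a) (fun _ ha => ha)
    (fun _ _ _ _ hab => (affine_injective hab).2) (Set.toFinite (H : Set (PGLTwo L)))

theorem card_range_subgroupMultiplier_dvd [Finite H] :
    Nat.card (subgroupMultiplier H).range ∣ Nat.card (translationLengths H) - 1 := by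
  have hS : ((translationLengths H : Set L) \ {0}).ncard = Nat.card (translationLengths H) - 1 := by
    rw [Set.ncard_sdiff_singleton_of_mem (zero_mem (translationLengths H)), Set.ncard_def]
    rfl
  rw [← hS]
  have : Finite (subgroupMultiplier H).range := Set.finite_range (subgroupMultiplier H)
  refine card_dvd_ncard_of_free (finite_translationLengths H).sdiff ?_ ?_
  · rintro u x ⟨hx, hx0⟩
    exact ⟨mul_mem_translationLengths u.2 hx, mul_ne_zero u.1.ne_zero hx0⟩
  · rintro u x ⟨hx, hx0⟩ h
    exact Subtype.ext (Units.ext (mul_right_cancel₀ hx0 (h.trans (one_mul x).symm)))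

theorem _root_.RingHom.mem_range_iff_pow_card_eq {K : Type*} [Field K] [Finite K] (f : K →+* L)
    {x : L} : x ∈ Set.range f ↔ x ^ Nat.card K = x := by
  classical
  have := Fintype.ofFinite K
  have h1 : 1 < Nat.card K := Finite.one_lt_card
  have hne : (Polynomial.X ^ Nat.card K - Polynomial.X : Polynomial L) ≠ 0 :=
    FiniteField.X_pow_card_sub_X_ne_zero L h1
  set R : Finset L := (Polynomial.X ^ Nat.card K - Polynomial.X : Polynomial L).roots.toFinset
  have hR : ∀ y, y ∈ R ↔ y ^ Nat.card K = y := by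
    intro y
    rw [Multiset.mem_toFinset, Polynomial.mem_roots hne, Polynomial.IsRoot, Polynomial.eval_sub,
      Polynomial.eval_pow, Polynomial.eval_X, sub_eq_zero]
  have hsub : Finset.univ.image f ⊆ R := by
    intro y hy
    obtain ⟨k, -, rfl⟩ := Finset.mem_image.1 hy
    rw [hR, ← map_pow, Nat.card_eq_fintype_card, FiniteField.pow_card]
  have hcard : R.card ≤ (Finset.univ.image f).card := by
    rw [Finset.card_image_of_injective _ f.injective, Finset.card_univ, ← Nat.card_eq_fintype_card]
    refine (Multiset.toFinset_card_le _).trans ((Polynomial.card_roots' _).trans ?_)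
    rw [FiniteField.X_pow_card_sub_X_natDegree_eq L h1]
  rw [← hR, ← Finset.eq_of_subset_of_card_le hsub hcard]
  simp

/-- A subgroup of `PGL₂` containing the translation by `1` and having at least half as many
multipliers as it has nontrivial translations has a subfield as its group of translation lengths. -/
theorem translationLengths_eq_range [Finite H] {K : Type*} [Field K] [Finite K] (f : K →+* L)
    (h1 : affine 1 1 ∈ H) (hK : Nat.card (translationLengths H) = Nat.card K)
    (hle : Nat.card K - 1 ≤ 2 * Nat.card (subgroupMultiplier H).range) :
    (translationLengths H : Set L) = Set.range f := by
  set F := f.range.toAddSubgroup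
  have hF : (F : Set L) = Set.range f := rfl
  have : Finite (subgroupMultiplier H).range :=
    Set.finite_range (subgroupMultiplier H)
  have hFcard : Nat.card F = Nat.card K :=
    (Nat.card_congr (Equiv.ofInjective f f.injective)).symm
  set I := translationLengths H ⊓ F
  have hsub : insert 0 ((fun u : Lˣ => (u : L)) '' (subgroupMultiplier H).range) ⊆ (I : Set L) := by
    rw [Set.insert_subset_iff]
    refine ⟨zero_mem I, ?_⟩
    rintro _ ⟨u, hu, rfl⟩
    refine ⟨?_, ?_⟩
    · simpa using mul_mem_translationLengths hu h1
    · change (u : L) ∈ Set.range f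
      rw [RingHom.mem_range_iff_pow_card_eq]
      have hu1 : u ^ (Nat.card K - 1) = 1 := by
        obtain ⟨m, hm⟩ := card_range_subgroupMultiplier_dvd (H := H)
        rw [← hK, hm, pow_mul]
        have : u ^ Nat.card (subgroupMultiplier H).range = 1 := by
          have := pow_card_eq_one' (x := (⟨u, hu⟩ : (subgroupMultiplier H).range))
          exact congrArg Subtype.val this
        rw [this, one_pow]
      have := congrArg (fun v : Lˣ => (v : L)) hu1
      simp only [Units.val_pow_eq_pow_val, Units.val_one] at this
      rw [← Nat.sub_add_cancel (Nat.card_pos (α := K)), pow_succ, this, one_mul]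
  have hIfin : (I : Set L).Finite := (Set.finite_range f).subset fun x hx => hx.2
  have hcardI : Nat.card (subgroupMultiplier H).range + 1 ≤ Nat.card I := by
    have := Set.ncard_le_ncard hsub hIfin
    rwa [Set.ncard_insert_of_notMem (by rintro ⟨u, -, hu⟩; exact u.ne_zero hu)
      ((Set.toFinite ((subgroupMultiplier H).range : Set Lˣ)).image _),
      Set.ncard_image_of_injective _ Units.val_injective] at this
  have hfull : ∀ B : AddSubgroup L, I ≤ B → Nat.card B = Nat.card K → I = B := by
    intro B hIB hB
    have : Finite B := Nat.finite_of_card_ne_zero (hB ▸ Nat.card_pos.ne')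
    refine AddSubgroup.eq_of_le_of_card_ge hIB ?_
    obtain ⟨m, hm⟩ := AddSubgroup.card_dvd_of_le hIB
    have hpos : 0 < Nat.card B := Nat.card_pos
    have : m < 2 := by
      by_contra hm2
      have := Nat.mul_le_mul_left (Nat.card I) (not_lt.1 hm2)
      omega
    interval_cases m <;> omega
  rw [← hF, ← hfull _ inf_le_left hK, hfull _ inf_le_right hFcard]

theorem coe_mem_range_map {K L : Type*} {f : K → L} {a : L} :
    (a : OnePoint L) ∈ Set.range (OnePoint.map f) ↔ a ∈ Set.range f := by
  constructor
  · rintro ⟨x, hx⟩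
    cases x with
    | infty => exact absurd hx.symm (OnePoint.coe_ne_infty _)
    | coe x => exact ⟨x, OnePoint.coe_eq_coe.1 hx⟩
  · rintro ⟨x, rfl⟩
    exact ⟨x, rfl⟩

theorem mem_range_of_affine_mem_projGL {K : Type*} [Field K] {f : K →+* L} {u : Lˣ} {b : L}
    (h : affine u b ∈ projGL f) : (u : L) ∈ Set.range f := by
  have h0 := smul_mem_range_map h (coe_mem_range_map.2 ⟨0, map_zero f⟩)
  have h1 := smul_mem_range_map h (coe_mem_range_map.2 ⟨1, map_one f⟩)
  rw [affine_smul_coe, coe_mem_range_map] at h0 h1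
  obtain ⟨y, hy⟩ := h0
  obtain ⟨z, hz⟩ := h1
  exact ⟨z - y, by rw [map_sub, hy, hz]; ring⟩

@[simp]
theorem inversion_mul_self : (inversion * inversion : PGLTwo L) = 1 := by
  rw [inversion, ← map_mul, ← map_one mk]
  congr 1
  ext i j
  fin_cases i <;> fin_cases j <;>
    simp [Matrix.GeneralLinearGroup.mkOfDetNeZero, Matrix.mul_apply, Fin.sum_univ_two]

theorem orbit_infty_eq [Finite H] (h0 : ((0 : L) : OnePoint L) ∈ orbit H (∞ : OnePoint L))
    (hcard : Nat.card (orbit H (∞ : OnePoint L)) = Nat.card (translationLengths H) + 1) :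
    orbit H (∞ : OnePoint L) =
      insert ∞ ((fun a : L => (a : OnePoint L)) '' (translationLengths H : Set L)) := by
  symm
  have hfin := finite_translationLengths H
  refine Set.eq_of_subset_of_ncard_le ?_ ?_ (Set.finite_range _)
  · rw [Set.insert_subset_iff]
    refine ⟨mem_orbit_self _, ?_⟩
    rintro _ ⟨a, ha, rfl⟩
    have key : (⟨affine 1 a, mem_translationLengths.1 ha⟩ : H) • ((0 : L) : OnePoint L) =
        (a : OnePoint L) := by
      rw [Subgroup.mk_smul, affine_smul_coe]; simp
    change (a : OnePoint L) ∈ _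
    rw [← key]
    exact mem_orbit_of_mem_orbit _ h0
  · rw [Set.ncard_insert_of_notMem (by simp) (hfin.image _),
      Set.ncard_image_of_injective _ OnePoint.coe_injective]
    exact hcard.le

theorem exists_eq_projSL_or_eq_projGL_of_affine_one_mem [IsAlgClosed L] {p : ℕ} [Fact p.Prime]
    [CharP L p] (hp : 3 < p) [Finite H] (h1 : affine 1 1 ∈ H)
    (h0 : ∃ h ∈ H, h • (∞ : OnePoint L) = ((0 : L) : OnePoint L)) :
    ∃ s : ℕ, 0 < s ∧ ∃ f : GaloisField p s →+* L, H = projSL f ∨ H = projGL f := by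
  have hU := isUnipotentFamily_subgroupOf H
  obtain ⟨h, hH, h0⟩ := h0
  have hmove : ∃ g : H, g • (∞ : OnePoint L) ≠ ∞ := ⟨⟨h, hH⟩, by
    rw [Subgroup.mk_smul, h0]; exact OnePoint.coe_ne_infty _⟩
  obtain ⟨s, hs⟩ := IsPGroup.iff_card.1 (isPGroup_unipotents_subgroupOf H p (∞ : OnePoint L))
  have hq : Nat.card (translationLengths H) = p ^ s := (card_translationLengths H).trans hs
  have hs0 : s ≠ 0 := by
    rintro rfl
    rw [pow_zero, AddSubgroup.card_eq_one] at hq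
    have : (1 : L) ∈ translationLengths H := h1
    rw [hq, AddSubgroup.mem_bot] at this
    exact one_ne_zero this
  have hq3 : 3 < p ^ s := hp.trans_le (Nat.le_self_pow hs0 p)
  obtain ⟨horb, hle⟩ := card_orbit_of_unipotent (p := p) hU
    (fun g hg => ncard_fixedBy (g := (g : PGLTwo L)) (by simpa using hg))
    (isPGroup_unipotents_subgroupOf H p)
    (fun x hx g hg k hk => mul_comm_of_unipotents_subgroupOf_eq_bot hx hg hk)
    hmove hs hq3 (by rw [← hq]; exact card_stabilizer_infty)
    (by rw [← hq]; exact card_range_subgroupMultiplier_dvd)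
  let _ : Algebra (ZMod p) L := ZMod.algebra L p
  let f : GaloisField p s →+* L :=
    ((IsAlgClosed.lift : GaloisField p s →ₐ[ZMod p] L) : GaloisField p s →+* L)
  have hK : Nat.card (GaloisField p s) = p ^ s := GaloisField.card p s hs0
  have hA : (translationLengths H : Set L) = Set.range f :=
    translationLengths_eq_range f h1 (hq.trans hK.symm) (hK.symm ▸ hle)
  have horbit : orbit H (∞ : OnePoint L) = Set.range (OnePoint.map f) := by
    rw [orbit_infty_eq ⟨⟨h, hH⟩, h0⟩ (horb.trans (by rw [hq])), hA]
    ext x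
    cases x with
    | infty => simp only [Set.mem_insert_iff, true_or, true_iff]; exact ⟨∞, rfl⟩
    | coe x =>
      rw [coe_mem_range_map]
      simp
  have hinv : ∀ g ∈ H, ∀ x : OnePoint (GaloisField p s),
      g • (OnePoint.map f x) ∈ Set.range (OnePoint.map f) := by
    intro g hg x
    have : OnePoint.map f x ∈ orbit H (∞ : OnePoint L) := horbit ▸ Set.mem_range_self x
    rw [← horbit]
    exact mem_orbit_of_mem_orbit (⟨g, hg⟩ : H) this
  have hleGL : H ≤ projGL f := fun g hg =>
    mem_projGL (hinv g hg ∞) (by simpa using hinv g hg ((0 : GaloisField p s) : OnePoint _))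
      (by simpa using hinv g hg ((1 : GaloisField p s) : OnePoint _))
  have hup : ∀ a, affine 1 (f a) ∈ H := fun a => by
    have : f a ∈ (translationLengths H : Set L) := hA ▸ Set.mem_range_self a
    exact this
  refine ⟨s, Nat.pos_of_ne_zero hs0, f, eq_projSL_or_eq_projGL (projSL_le hup fun a => ?_) hleGL⟩
  obtain ⟨u, b, hub⟩ := exists_eq_affine (g := inversion * h) (by simp [mul_smul, h0])
  obtain ⟨k, hk⟩ : (u : L) ∈ Set.range f := mem_range_of_affine_mem_projGL (f := f) (b := b) (by
    rw [← hub]; exact mul_mem (inversion_mem_projGL f) (hleGL hH))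
  have hk0 : k ≠ 0 := by
    rintro rfl
    exact u.ne_zero (by rw [← hk, map_zero])
  have hh : h = inversion * affine u b := by rw [← hub, ← mul_assoc, inversion_mul_self, one_mul]
  have key : h * affine 1 (f (k⁻¹ * a)) * h⁻¹ = inversion * affine 1 (f a) * inversion := by
    rw [mul_inv_eq_iff_eq_mul, hh]
    simp only [mul_assoc]
    rw [← mul_assoc inversion inversion, inversion_mul_self, one_mul, affine_mul, affine_mul,
      ← hk, ← map_mul, mul_inv_cancel_left₀ hk0]
    simp [add_comm]
  rw [← key]
  exact H.mul_mem (H.mul_mem hH (hup _)) (H.inv_mem hH)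

end Unipotent

section Classification

variable {L : Type*} [Field L] {H : Subgroup (PGLTwo L)}

theorem exists_conj_upperTriangular {x : OnePoint L} (hx : ∀ h ∈ H, h • x = x) :
    ∃ g : PGLTwo L, ∀ h ∈ H, ∃ M : GL (Fin 2) L, (M : Matrix (Fin 2) (Fin 2) L) 1 0 = 0 ∧
      mk M = g * h * g⁻¹ := by
  obtain ⟨g, hg⟩ := exists_smul_eq_infty x
  refine ⟨g, fun h hh => ?_⟩
  obtain ⟨M, hM⟩ := QuotientGroup.mk'_surjective (Subgroup.center (GL (Fin 2) L)) (g * h * g⁻¹)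
  refine ⟨M, ?_, hM⟩
  apply mk_smul_infty_eq_infty.1
  have : g⁻¹ • (∞ : OnePoint L) = x := by rw [← hg, inv_smul_smul]
  rw [mk, hM, mul_smul, mul_smul, this, hx h hh, hg]

open scoped Pointwise in
theorem conj_mem_translations_iff {k g : PGLTwo L} {x : OnePoint L} (hk : k • x = ∞) :
    k * g * k⁻¹ ∈ translations L ↔ g ∈ unipotents x := by
  rw [mem_translations_iff_fixedBy, ← smul_fixedBy, ← hk, ← Set.smul_set_singleton,
    smul_left_cancel_iff, conj_eq_one_iff, isUnipotentFamily_unipotents]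

theorem isCyclic_stabilizer [Finite H] {x : OnePoint L} (hx : (unipotents x).subgroupOf H = ⊥) :
    IsCyclic (stabilizer H x) := by
  obtain ⟨k, hk⟩ := exists_smul_eq_infty x
  have hk' : k⁻¹ • (∞ : OnePoint L) = x := by rw [← hk, inv_smul_smul]
  let φ : stabilizer H x →* Lˣ := multiplier.comp
    (((MulAut.conj k).toMonoidHom.comp (H.subtype.comp (stabilizer H x).subtype)).codRestrict _
      fun g => by
        have hg : (g : PGLTwo L) • x = x := g.2
        change (k * (g : PGLTwo L) * k⁻¹) • (∞ : OnePoint L) = ∞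
        rw [mul_smul, mul_smul, hk', hg, hk])
  refine isCyclic_of_injective_ringHom ((Units.coeHom L).comp φ)
    (Units.val_injective.comp ((injective_iff_map_eq_one φ).2 fun g hg => ?_))
  have hg' : k * (g : PGLTwo L) * k⁻¹ ∈ translations L := multiplier_eq_one_iff.1 hg
  rw [conj_mem_translations_iff hk, ← Subgroup.mem_subgroupOf, hx, Subgroup.mem_bot] at hg'
  exact Subtype.ext hg'

theorem exists_mulEquiv_dihedralGroup_of_unipotents_eq_bot [IsAlgClosed L] [Finite H]
    (hU : ∀ x : OnePoint L, (unipotents x).subgroupOf H = ⊥) (hbig : ∃ g ∈ H, 5 < orderOf g)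
    (hmove : ∀ x : OnePoint L, ∃ h : H, h • x ≠ x) :
    ∃ n : ℕ, Nonempty (H ≃* DihedralGroup n) := by
  have hfix : ∀ g : H, g ≠ 1 → (fixedBy (OnePoint L) g).ncard = 2 := by
    intro g hg
    refine (ncard_fixedBy (g := (g : PGLTwo L)) (by simpa using hg)).resolve_left fun h1 => hg ?_
    obtain ⟨x, hx⟩ := Set.ncard_eq_one.1 h1
    rw [← Subgroup.mem_bot, ← hU x]
    exact (isUnipotentFamily_subgroupOf H x g).2 (Or.inr hx)
  obtain ⟨g, hg, hord⟩ := hbig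
  obtain ⟨x, hx⟩ := exists_smul_eq g
  have hst : 6 ≤ Nat.card (stabilizer H x) := by
    have h := Nat.le_of_dvd Nat.card_pos
      (orderOf_dvd_natCard (⟨⟨g, hg⟩, hx⟩ : stabilizer H x))
    rw [← Subgroup.orderOf_coe, ← Subgroup.orderOf_coe] at h
    exact hord.trans_le h
  have horb := exists_card_orbit_eq_two hfix hmove hst
  have : IsCyclic (stabilizer H x) := isCyclic_stabilizer (hU x)
  refine exists_mulEquiv_dihedralGroup (K := stabilizer H x) ((index_stabilizer H x).trans horb) ?_
  intro h hh
  have hhx : h • x ≠ x := hh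
  have hhhx : h • h • x = x := by
    by_contra hne
    have hsub : ({x, h • x, h • h • x} : Set (OnePoint L)) ⊆ orbit H x := by
      rintro _ (rfl | rfl | rfl)
      · exact mem_orbit_self _
      · exact mem_orbit _ _
      · exact mem_orbit_of_mem_orbit _ (mem_orbit _ _)
    have := Set.ncard_le_ncard hsub (Set.finite_range _)
    rw [Set.ncard_eq_three.2 ⟨_, _, _, hhx.symm, fun h' => hne h'.symm,
      fun h' => hhx (smul_left_cancel h h').symm, rfl⟩] at this
    change 3 ≤ Nat.card (orbit H x) at this
    omega
  obtain ⟨z, hz⟩ := exists_smul_eq (h : PGLTwo L)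
  replace hz : h • z = z := hz
  have hzx : z ≠ x := by rintro rfl; exact hhx hz
  have hzy : z ≠ h • x := by
    rintro rfl
    exact hhx (hz.symm.trans hhhx)
  by_contra hne
  have hsub : ({x, h • x, z} : Set (OnePoint L)) ⊆ fixedBy (OnePoint L) (h * h) := by
    rintro _ (rfl | rfl | rfl) <;> simp [mul_smul, hhhx, hz]
  have hcard := hfix _ hne
  have := Set.ncard_le_ncard hsub (Set.finite_of_ncard_ne_zero (by omega))
  rw [Set.ncard_eq_three.2 ⟨_, _, _, hhx.symm, hzx.symm, hzy.symm, rfl⟩] at this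
  omega

theorem exists_conj_eq_projSL_or_eq_projGL [IsAlgClosed L] {p : ℕ} [Fact p.Prime]
    [CharP L p] (hp : 3 < p) [Finite H] {x : OnePoint L} (hx : (unipotents x).subgroupOf H ≠ ⊥)
    (hmove : ∃ h : H, h • x ≠ x) :
    ∃ s : ℕ, 0 < s ∧ ∃ (f : GaloisField p s →+* L) (g : PGLTwo L),
      Subgroup.map (MulAut.conj g).toMonoidHom H = projSL f ∨
      Subgroup.map (MulAut.conj g).toMonoidHom H = projGL f := by
  obtain ⟨⟨u, hu⟩, hu1⟩ := Subgroup.ne_bot_iff_exists_ne_one.1 hx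
  replace hu1 : u ≠ 1 := fun h => hu1 (Subtype.ext h)
  obtain ⟨h, hhx⟩ := hmove
  have hfix : fixedBy (OnePoint L) (u : PGLTwo L) = {x} :=
    ((isUnipotentFamily_subgroupOf H x u).1 hu).resolve_left hu1
  have hux : u • x = x := (isUnipotentFamily_subgroupOf H).le_stabilizer x hu
  have hzy : u • h • x ≠ h • x := by
    intro h'
    have : h • x ∈ fixedBy (OnePoint L) (u : PGLTwo L) := h'
    rw [hfix] at this
    exact hhx this
  have hzx : u • h • x ≠ x := fun h' => hhx (smul_left_cancel u (h'.trans hux.symm))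
  obtain ⟨g, hgx, hgy, hgz⟩ := exists_smul_eq_infty_zero_one hhx hzx hzy
  have hg : g⁻¹ • (∞ : OnePoint L) = x := by rw [← hgx, inv_smul_smul]
  have hg0 : g⁻¹ • ((0 : L) : OnePoint L) = h • x := by rw [← hgy, inv_smul_smul]
  obtain ⟨b, hb⟩ := (conj_mem_translations_iff hgx).2 (Subgroup.mem_subgroupOf.1 hu)
  replace hb : affine 1 b = g * (u : PGLTwo L) * g⁻¹ := hb
  have hb1 : b = 1 := by
    have h2 : (g * (u : PGLTwo L) * g⁻¹) • ((0 : L) : OnePoint L) = ((1 : L) : OnePoint L) := by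
      rw [mul_smul, mul_smul, hg0]
      exact hgz
    rw [← hb, affine_smul_coe, OnePoint.coe_eq_coe] at h2
    simpa using h2
  rw [hb1] at hb
  have : Finite (Subgroup.map (MulAut.conj g).toMonoidHom H) :=
    (Set.toFinite (H : Set (PGLTwo L))).image _
  obtain ⟨s, hs, f, hf⟩ := exists_eq_projSL_or_eq_projGL_of_affine_one_mem
    (H := Subgroup.map (MulAut.conj g).toMonoidHom H) hp ⟨u, u.2, hb.symm⟩
    ⟨g * h * g⁻¹, ⟨h, h.2, rfl⟩, by rw [mul_smul, mul_smul, hg]; exact hgy⟩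
  exact ⟨s, hs, f, g, hf⟩

end Classification

end PGLTwo

/-- Dickson: a finite subgroup of PGL₂(𝔽̄_ℓ) (ℓ > 5) containing an
element of order > 5, acting irreducibly, not conjugate into the upper triangular
matrices and not dihedral, is conjugate to PSL₂(𝔽_{ℓ^s}) or PGL₂(𝔽_{ℓ^s}) for
some s > 0 (realized via an embedding of the field with ℓ^s elements into 𝔽̄_ℓ). -/
theorem stmt_17 (ℓ : ℕ) [hℓ : Fact (Nat.Prime ℓ)] (hℓ5 : 5 < ℓ)
    (L : Type) [Field L] [IsAlgClosed L] [CharP L ℓ]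
    (H : Subgroup (GL (Fin 2) L ⧸ Subgroup.center (GL (Fin 2) L))) (hfin : Finite H)
    (hbig : ∃ x ∈ H, 5 < orderOf x)
    (hirr : ∀ W : Submodule L (Fin 2 → L),
      (∀ M : GL (Fin 2) L, QuotientGroup.mk' (Subgroup.center (GL (Fin 2) L)) M ∈ H →
        W.map (Matrix.toLin' ((M : Matrix (Fin 2) (Fin 2) L))) ≤ W) →
      W = ⊥ ∨ W = ⊤)
    (htri : ¬ ∃ g : GL (Fin 2) L ⧸ Subgroup.center (GL (Fin 2) L), ∀ x ∈ H,
      ∃ M : GL (Fin 2) L, (M : Matrix (Fin 2) (Fin 2) L) 1 0 = 0 ∧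
        QuotientGroup.mk' (Subgroup.center (GL (Fin 2) L)) M = g * x * g⁻¹)
    (hdih : ¬ ∃ n : ℕ, Nonempty (↥H ≃* DihedralGroup n)) :
    ∃ s : ℕ, 0 < s ∧ ∃ (f : GaloisField ℓ s →+* L)
      (g : GL (Fin 2) L ⧸ Subgroup.center (GL (Fin 2) L)),
      Subgroup.map (MulAut.conj g).toMonoidHom H =
        ((QuotientGroup.mk' (Subgroup.center (GL (Fin 2) L))).comp
          ((Units.map (RingHom.mapMatrix f).toMonoidHom).comp
            Matrix.SpecialLinearGroup.toGL)).range ∨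
      Subgroup.map (MulAut.conj g).toMonoidHom H =
        ((QuotientGroup.mk' (Subgroup.center (GL (Fin 2) L))).comp
          (Units.map (RingHom.mapMatrix f).toMonoidHom)).range := by
  have hp : 3 < ℓ := by omega
  have hmove : ∀ x : OnePoint L, ∃ h : H, h • x ≠ x := by
    by_contra! h
    obtain ⟨x, hx⟩ := h
    exact htri (PGLTwo.exists_conj_upperTriangular fun h hh => hx ⟨h, hh⟩)
  by_cases hU : ∀ x : OnePoint L, (PGLTwo.unipotents x).subgroupOf H = ⊥
  · exact absurd (PGLTwo.exists_mulEquiv_dihedralGroup_of_unipotents_eq_bot hU hbig hmove) hdih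
  · push Not at hU
    obtain ⟨x, hx⟩ := hU
    exact PGLTwo.exists_conj_eq_projSL_or_eq_projGL hp hx (hmove x)
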